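/- Few errors force the reduced polynomial to vanish: In the setting of the previous lemma (𝓣 linearly-extendible, (𝓣,𝓖) list-composing in terms of 𝓛 at A = ((x_0,y_0),…,(x_{n−1},y_{n−1})), Q_0,…,Q_{w−1} satisfying the interpolation constraints for the received word c, each G_i degree-preserving in both X and Y, deg_X Q_i ≤ d1−t, deg_Y Q_i ≤ d2−k), suppose additionally that every nonzero R ∈ F[X,Y] with deg_X R < d1 and deg_Y R < d2 satisfies 𝓣(R)(x_i,y_i) ≠ 0 for at least D indices i ∈ {0,…,n−1}. Then for every p ∈ F[X,Y] with deg_X p < t and deg_Y p < k such that #{i : 𝓛(p)(x_i,y_i) ≠ c_i} < D, the polynomial R_p = Σ_{i=0}^{w−1} Q_i·G_i(p) is identically zero. -/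

import Mathlib

open MvPolynomial

noncomputable section

/-- `deg_X p < t` and `deg_Y p < k` (with the convention `deg 0 = -∞`). -/
def DegLT (F : Type) [Field F] (t k : ℕ) (p : MvPolynomial (Fin 2) F) : Prop :=
  ∀ m ∈ p.support, m 0 < t ∧ m 1 < k

/-- A linear operator on `F[X,Y]` is degree-preserving in both `X` and `Y`. -/
def DegPres (F : Type) [Field F]
    (G : MvPolynomial (Fin 2) F →ₗ[F] MvPolynomial (Fin 2) F) : Prop :=
  ∀ p : MvPolynomial (Fin 2) F, p ≠ 0 →
    G p ≠ 0 ∧ (G p).degreeOf 0 = p.degreeOf 0 ∧ (G p).degreeOf 1 = p.degreeOf 1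

/-- A bivariate family of linear operators is linearly-extendible, witnessed by
matrices `Mx`, `My` over `F[X,Y]`. -/
def LinExt (F : Type) [Field F] (r : ℕ)
    (T : Fin r → MvPolynomial (Fin 2) F →ₗ[F] MvPolynomial (Fin 2) F)
    (Mx My : Matrix (Fin r) (Fin r) (MvPolynomial (Fin 2) F)) : Prop :=
  (∀ p, (fun i => T i (X 0 * p)) = Mx.mulVec fun i => T i p) ∧
  (∀ p, (fun i => T i (X 1 * p)) = My.mulVec fun i => T i p)

/-- `q(Mx, My)`: the matrix obtained from `q ∈ F[X,Y]` by substituting each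
monomial `X^a Y^b` (with its coefficient) by `Mx^a · My^b`. -/
def matSubst (F : Type) [Field F] {r : ℕ} (q : MvPolynomial (Fin 2) F)
    (Mx My : Matrix (Fin r) (Fin r) (MvPolynomial (Fin 2) F)) :
    Matrix (Fin r) (Fin r) (MvPolynomial (Fin 2) F) :=
  ∑ m ∈ q.support, MvPolynomial.coeff m q • (Mx ^ (m 0) * My ^ (m 1))

theorem LinExt.apply_pow_mul_pow_mul {F : Type} [Field F] {r : ℕ}
    {T : Fin r → MvPolynomial (Fin 2) F →ₗ[F] MvPolynomial (Fin 2) F}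
    {Mx My : Matrix (Fin r) (Fin r) (MvPolynomial (Fin 2) F)}
    (hT : LinExt F r T Mx My) (a b : ℕ) (p : MvPolynomial (Fin 2) F) :
    (fun i => T i (X 0 ^ a * X 1 ^ b * p)) = (Mx ^ a * My ^ b).mulVec fun i => T i p := by
  induction a with
  | zero =>
    induction b with
    | zero => simp
    | succ b ih =>
      simp only [pow_zero, one_mul] at ih ⊢
      rw [pow_succ' (X 1), mul_assoc, hT.2, ih, Matrix.mulVec_mulVec, ← pow_succ']
  | succ a ih =>
    rw [pow_succ' (X 0), mul_assoc, mul_assoc, ← mul_assoc (X 0 ^ a), hT.1, ih,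
      Matrix.mulVec_mulVec, ← mul_assoc, ← pow_succ']

/-- Multiplication by `q` acts on a linearly-extendible family through `q(Mx, My)`. -/
theorem LinExt.apply_mul {F : Type} [Field F] {r : ℕ}
    {T : Fin r → MvPolynomial (Fin 2) F →ₗ[F] MvPolynomial (Fin 2) F}
    {Mx My : Matrix (Fin r) (Fin r) (MvPolynomial (Fin 2) F)}
    (hT : LinExt F r T Mx My) (q p : MvPolynomial (Fin 2) F) :
    (fun i => T i (q * p)) = (matSubst F q Mx My).mulVec fun i => T i p := by
  have hq : q * p = ∑ m ∈ q.support, coeff m q • (X 0 ^ m 0 * X 1 ^ m 1 * p) := by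
    conv_lhs => rw [q.as_sum, Finset.sum_mul]
    refine Finset.sum_congr rfl fun m _ => ?_
    rw [monomial_eq, Finsupp.prod_fintype _ _ (by simp), Fin.prod_univ_two, smul_eq_C_mul,
      mul_assoc (C _)]
  rw [matSubst, Matrix.sum_mulVec, hq]
  ext1 i
  simp only [map_sum, map_smul, Finset.sum_apply, Matrix.smul_mulVec, Pi.smul_apply]
  refine Finset.sum_congr rfl fun m _ => ?_
  rw [← hT.apply_pow_mul_pow_mul]

theorem degLT_iff_degreeOf_lt {F : Type} [Field F] {t k : ℕ} {p : MvPolynomial (Fin 2) F}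
    (hp : p ≠ 0) : DegLT F t k p ↔ p.degreeOf 0 < t ∧ p.degreeOf 1 < k := by
  obtain ⟨m, hm⟩ := support_nonempty.2 hp
  constructor
  · intro h
    exact ⟨(degreeOf_lt_iff (by have := h m hm; omega)).2 fun m hm => (h m hm).1,
      (degreeOf_lt_iff (by have := h m hm; omega)).2 fun m hm => (h m hm).2⟩
  · rintro ⟨h0, h1⟩ m hm
    exact ⟨(degreeOf_lt_iff (by omega)).1 h0 m hm, (degreeOf_lt_iff (by omega)).1 h1 m hm⟩

theorem DegLT.sum {F : Type} [Field F] {t k : ℕ} {ι : Type*} {S : Finset ι}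
    {f : ι → MvPolynomial (Fin 2) F} (h : ∀ i ∈ S, DegLT F t k (f i)) :
    DegLT F t k (∑ i ∈ S, f i) := by
  classical
  intro m hm
  obtain ⟨i, hi, hmi⟩ := Finset.mem_biUnion.1 (support_sum hm)
  exact h i hi m hmi

theorem DegLT.mul {F : Type} [Field F] {t k a b : ℕ} {p q : MvPolynomial (Fin 2) F}
    (hp : DegLT F t k p) (hq : q.degreeOf 0 ≤ a ∧ q.degreeOf 1 ≤ b) :
    DegLT F (a + t) (b + k) (q * p) := by
  classical
  intro m hm
  obtain ⟨u, hu, v, hv, rfl⟩ := Finset.mem_add.1 (support_mul q p hm)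
  have hv' := hp v hv
  have h0 := (monomial_le_degreeOf 0 hu).trans hq.1
  have h1 := (monomial_le_degreeOf 1 hu).trans hq.2
  simp only [Finsupp.add_apply]
  omega

theorem DegPres.degLT {F : Type} [Field F] {t k : ℕ}
    {G : MvPolynomial (Fin 2) F →ₗ[F] MvPolynomial (Fin 2) F} (hG : DegPres F G)
    {p : MvPolynomial (Fin 2) F} (hp : DegLT F t k p) : DegLT F t k (G p) := by
  by_cases h0 : p = 0
  · simpa [h0] using hp
  obtain ⟨hne, hx, hy⟩ := hG p h0
  rw [degLT_iff_degreeOf_lt hne, hx, hy]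
  exact (degLT_iff_degreeOf_lt h0).1 hp

/-- Few errors force the reduced polynomial to vanish: if fewer than `D` coordinates
of the encoding of `p` disagree with the received word `c`, then
`R_p = Σ_i Q_i · G_i(p)` is identically zero. -/
theorem few_errors_force_vanishing
    {F : Type} [Field F] {s w r n t k d1 d2 D : ℕ}
    (L : Fin s → MvPolynomial (Fin 2) F →ₗ[F] MvPolynomial (Fin 2) F)
    (G : Fin w → MvPolynomial (Fin 2) F →ₗ[F] MvPolynomial (Fin 2) F)
    (T : Fin r → MvPolynomial (Fin 2) F →ₗ[F] MvPolynomial (Fin 2) F)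
    (Mx My : Matrix (Fin r) (Fin r) (MvPolynomial (Fin 2) F))
    (hT : LinExt F r T Mx My)
    (A : Fin n → F × F)
    (h : Fin w → Fin n → ((Fin s → F) →ₗ[F] (Fin r → F)))
    (hcomp : ∀ (i : Fin w) (m : Fin n) (p : MvPolynomial (Fin 2) F),
      (fun j : Fin r => eval ![(A m).1, (A m).2] (T j (G i p)))
        = h i m fun j : Fin s => eval ![(A m).1, (A m).2] (L j p))
    (c : Fin n → Fin s → F)
    (Q : Fin w → MvPolynomial (Fin 2) F)
    (hQ : ∀ m : Fin n,
      (∑ i : Fin w,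
        ((matSubst F (Q i) Mx My).map (eval ![(A m).1, (A m).2])).mulVec
          (h i m (c m))) = 0)
    (hG : ∀ i : Fin w, DegPres F (G i))
    (hQdeg : ∀ i : Fin w, (Q i).degreeOf 0 ≤ d1 - t ∧ (Q i).degreeOf 1 ≤ d2 - k)
    (hd1 : t ≤ d1) (hd2 : k ≤ d2)
    (hdist : ∀ R : MvPolynomial (Fin 2) F, R ≠ 0 → DegLT F d1 d2 R →
      D ≤ {i : Fin n | (fun j : Fin r => eval ![(A i).1, (A i).2] (T j R)) ≠ 0}.ncard) :
    ∀ p : MvPolynomial (Fin 2) F, DegLT F t k p →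
      {i : Fin n | (fun j : Fin s => eval ![(A i).1, (A i).2] (L j p)) ≠ c i}.ncard < D →
      (∑ i : Fin w, Q i * G i p) = 0 := by
  intro p hp hlt
  by_contra hR
  have hdeg : DegLT F d1 d2 (∑ i : Fin w, Q i * G i p) := by
    refine DegLT.sum fun i _ => ?_
    simpa [Nat.sub_add_cancel hd1, Nat.sub_add_cancel hd2] using
      ((hG i).degLT hp).mul (hQdeg i)
  refine absurd (hdist _ hR hdeg) (not_le.2 (lt_of_le_of_lt ?_ hlt))
  refine Set.ncard_le_ncard (fun m hm hc => hm ?_) (Set.toFinite _)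
  rw [← hQ m, ← hc]
  ext j
  simp only [← hcomp, map_sum, Finset.sum_apply]
  refine Finset.sum_congr rfl fun i _ => ?_
  rw [congrFun (hT.apply_mul (Q i) (G i p)) j, RingHom.map_mulVec]
  rfl
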